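/- For any four vectors a, b, c, d spanning a 3-dimensional subspace context in a vector space, if a, b, c, d are linearly dependent then the (2,2)-coproduct slice ab⊗cd − ac⊗bd + ad⊗bc + bc⊗ad − bd⊗ac + cd⊗ab is the zero element of Λ²(V) ⊗ Λ²(V). -/

import Mathlib

open ExteriorAlgebra TensorProduct

section

variable (k : Type*) {V : Type*} [Field k] [AddCommGroup V] [Module k V]

theorem ExteriorAlgebra.ι_mul_ι_eq_neg (x y : V) : ι k x * ι k y = -(ι k y * ι k x) :=
  eq_neg_of_add_eq_zero_left (ι_add_mul_swap x y)

/-- The `(2, 2)`-component of the coproduct of `v 0 ∧ v 1 ∧ v 2 ∧ v 3`, as an alternating map. -/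
noncomputable def coproductSlice :
    V [⋀^Fin 4]→ₗ[k] ExteriorAlgebra k V ⊗[k] ExteriorAlgebra k V where
  toFun v :=
    (ι k (v 0) * ι k (v 1)) ⊗ₜ[k] (ι k (v 2) * ι k (v 3))
      - (ι k (v 0) * ι k (v 2)) ⊗ₜ[k] (ι k (v 1) * ι k (v 3))
      + (ι k (v 0) * ι k (v 3)) ⊗ₜ[k] (ι k (v 1) * ι k (v 2))
      + (ι k (v 1) * ι k (v 2)) ⊗ₜ[k] (ι k (v 0) * ι k (v 3))
      - (ι k (v 1) * ι k (v 3)) ⊗ₜ[k] (ι k (v 0) * ι k (v 2))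
      + (ι k (v 2) * ι k (v 3)) ⊗ₜ[k] (ι k (v 0) * ι k (v 1))
  map_update_add' := by
    intro inst v i x y
    obtain rfl : inst = instDecidableEqFin 4 := Subsingleton.elim _ _
    fin_cases i <;>
      simp [add_mul, mul_add, add_tmul, tmul_add] <;> abel
  map_update_smul' := by
    intro inst v i r x
    obtain rfl : inst = instDecidableEqFin 4 := Subsingleton.elim _ _
    fin_cases i <;>
      simp [smul_add, smul_sub, smul_tmul']
  map_eq_zero_of_eq' v i j hv hij := by
    wlog hlt : i < j generalizing i j
    · exact this j i hv.symm hij.symm (lt_of_le_of_ne (not_lt.mp hlt) hij.symm)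
    have h₁ := ι_mul_ι_eq_neg k (v 1) (v 0)
    have h₂ := ι_mul_ι_eq_neg k (v 2) (v 0)
    have h₃ := ι_mul_ι_eq_neg k (v 2) (v 1)
    fin_cases i <;> fin_cases j <;> simp at hlt hv <;>
      simp [← hv, h₁, h₂, h₃, neg_tmul, tmul_neg]

end

theorem stmt_2 {k V : Type*} [Field k] [AddCommGroup V] [Module k V]
    (a b c d : V) (h : ¬ LinearIndependent k ![a, b, c, d]) :
    (ι k a * ι k b) ⊗ₜ[k] (ι k c * ι k d) - (ι k a * ι k c) ⊗ₜ[k] (ι k b * ι k d)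
      + (ι k a * ι k d) ⊗ₜ[k] (ι k b * ι k c) + (ι k b * ι k c) ⊗ₜ[k] (ι k a * ι k d)
      - (ι k b * ι k d) ⊗ₜ[k] (ι k a * ι k c) + (ι k c * ι k d) ⊗ₜ[k] (ι k a * ι k b)
      = (0 : ExteriorAlgebra k V ⊗[k] ExteriorAlgebra k V) :=
  (coproductSlice k).map_linearDependent ![a, b, c, d] h
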